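/- Let C = c cᵀ with c ∈ ℝ^n, and M_i = A_iᵀA_i for matrices A_i, i ∈ {1,…,l}. Consider the problem: supremum of ⟨c cᵀ, X⟩ over X symmetric positive semidefinite n×n and λ ∈ ℝ^q subject to ⟨M_i,X⟩ ≤ h_iᵀλ + b_i for all i. Assume (i) there exists λ̄ ∈ ℝ^q with h_iᵀλ̄ + b_i ≥ 0 for all i, and (ii) there exists μ̄ ∈ ℝ^l with μ̄ ≥ 0, Σ_i μ̄_i M_i − c cᵀ positive semidefinite, and Hμ̄ = 0. Then the supremum is finite and equals the square of the supremum of cᵀx over (x,λ) ∈ ℝ^n × ℝ^q subject to ‖A_i x‖₂² ≤ h_iᵀλ + b_i for all i. Moreover, if (x,λ) attains the latter supremum, then (x xᵀ, λ) attains the former, with value (cᵀx)². -/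

import Mathlib

open Matrix

lemma aux_tr {n k : ℕ} (A : Matrix (Fin k) (Fin n) ℝ) (B : Matrix (Fin n) (Fin n) ℝ) :
    (Aᵀ * A * (Bᵀ * B)).trace = ∑ j, (B *ᵥ A j) ⬝ᵥ (B *ᵥ A j) := by
  have h1 : (Aᵀ * A * (Bᵀ * B)).trace = ((B * Aᵀ)ᵀ * (B * Aᵀ)).trace := by
    rw [Matrix.mul_assoc, Matrix.trace_mul_comm, Matrix.transpose_mul, Matrix.transpose_transpose]
    simp only [Matrix.mul_assoc]
  rw [h1, Matrix.trace]
  refine Finset.sum_congr rfl fun j _ => ?_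
  simp [Matrix.mul_apply, Matrix.mulVec, dotProduct, mul_comm]

lemma aux_vv {n : ℕ} (c : Fin n → ℝ) (X : Matrix (Fin n) (Fin n) ℝ) :
    (vecMulVec c c * X).trace = c ⬝ᵥ (X *ᵥ c) := by
  rw [Matrix.trace_mul_comm, Matrix.mul_vecMulVec, Matrix.trace_vecMulVec, dotProduct_comm]

lemma aux_xx {n k : ℕ} (A : Matrix (Fin k) (Fin n) ℝ) (x : Fin n → ℝ) :
    (Aᵀ * A * vecMulVec x x).trace = (A *ᵥ x) ⬝ᵥ (A *ᵥ x) := by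
  rw [Matrix.mul_vecMulVec, Matrix.trace_vecMulVec, ← Matrix.mulVec_mulVec, dotProduct_comm,
    Matrix.dotProduct_mulVec, Matrix.vecMul_transpose]

lemma aux_cc {n : ℕ} (c x : Fin n → ℝ) :
    (vecMulVec c c * vecMulVec x x).trace = (c ⬝ᵥ x) ^ 2 := by
  rw [Matrix.vecMulVec_mul_vecMulVec, Matrix.trace_vecMulVec]
  simp [dotProduct_comm, pow_two]

lemma aux_psd {n : ℕ} (x : Fin n → ℝ) : (vecMulVec x x).PosSemidef := by
  simpa using Matrix.posSemidef_vecMulVec_self_star x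

lemma aux_key {n : ℕ} (c : Fin n → ℝ) (X : Matrix (Fin n) (Fin n) ℝ) (hX : X.PosSemidef) :
    0 ≤ (vecMulVec c c * X).trace ∧ ∃ y : Fin n → ℝ,
      c ⬝ᵥ y = √((vecMulVec c c * X).trace) ∧
      ∀ (k : ℕ) (A : Matrix (Fin k) (Fin n) ℝ), (A *ᵥ y) ⬝ᵥ (A *ᵥ y) ≤ (Aᵀ * A * X).trace := by
  obtain ⟨B, rfl⟩ : ∃ B : Matrix (Fin n) (Fin n) ℝ, X = Bᵀ * B := by
    open scoped MatrixOrder in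
    obtain ⟨B, hB⟩ := CStarAlgebra.nonneg_iff_eq_star_mul_self.mp hX.nonneg
    exact ⟨B, by simpa [Matrix.star_eq_conjTranspose] using hB⟩
  have hq : ∀ u v : Fin n → ℝ, u ⬝ᵥ ((Bᵀ * B) *ᵥ v) = (B *ᵥ u) ⬝ᵥ (B *ᵥ v) := by
    intro u v
    rw [← Matrix.mulVec_mulVec, Matrix.dotProduct_mulVec, Matrix.vecMul_transpose]
  rw [aux_vv, hq]
  have h0 : 0 ≤ (B *ᵥ c) ⬝ᵥ (B *ᵥ c) := Finset.sum_nonneg fun i _ => mul_self_nonneg _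
  refine ⟨h0, ?_⟩
  set s := (B *ᵥ c) ⬝ᵥ (B *ᵥ c) with hs
  refine ⟨(√s)⁻¹ • ((Bᵀ * B) *ᵥ c), ?_, ?_⟩
  · rw [dotProduct_smul, hq, ← hs, smul_eq_mul]
    rcases h0.eq_or_lt with h | h
    · simp [← h]
    · have := Real.sqrt_pos.mpr h
      have h2 := Real.mul_self_sqrt h0
      field_simp
      linarith
  · intro k A
    rw [aux_tr]
    refine Finset.sum_le_sum fun j _ => ?_
    have e : (A *ᵥ ((√s)⁻¹ • ((Bᵀ * B) *ᵥ c))) j = (√s)⁻¹ * ((B *ᵥ A j) ⬝ᵥ (B *ᵥ c)) := by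
      rw [Matrix.mulVec_smul, Pi.smul_apply, smul_eq_mul, ← hq]; rfl
    rw [e]
    have cs : ((B *ᵥ A j) ⬝ᵥ (B *ᵥ c)) ^ 2 ≤ ((B *ᵥ A j) ⬝ᵥ (B *ᵥ A j)) * s := by
      have := Finset.sum_mul_sq_le_sq_mul_sq Finset.univ (B *ᵥ A j) (B *ᵥ c)
      simpa [dotProduct, pow_two, hs] using this
    have hn : 0 ≤ (B *ᵥ A j) ⬝ᵥ (B *ᵥ A j) := Finset.sum_nonneg fun i _ => mul_self_nonneg _
    have e2 : (√s)⁻¹ * ((B *ᵥ A j) ⬝ᵥ (B *ᵥ c)) * ((√s)⁻¹ * ((B *ᵥ A j) ⬝ᵥ (B *ᵥ c)))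
        = ((B *ᵥ A j) ⬝ᵥ (B *ᵥ c)) ^ 2 / s := by
      have h2 := Real.mul_self_sqrt h0
      rw [div_eq_mul_inv]
      conv_rhs => rw [← h2]
      rw [mul_inv]; ring
    rw [e2]
    exact div_le_of_le_mul₀ h0 hn cs

/-- The "combined" semidefinite packing problem with rank-one objective `C = c cᵀ` and
extra linear variables `λ` reduces to an SOCP: under primal and dual feasibility, the
SDP value is finite and equals the square of the SOCP value, and an optimal `(x, λ)` of
the SOCP yields the optimal solution `(x xᵀ, λ)` of the SDP, with value `(cᵀx)²`. -/
theorem stmt_12 (n q l : ℕ) (m : Fin l → ℕ) (c : Fin n → ℝ)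
    (A : ∀ i, Matrix (Fin (m i)) (Fin n) ℝ)
    (h : Fin l → Fin q → ℝ) (b : Fin l → ℝ)
    (hfeas : ∃ lam : Fin q → ℝ, ∀ i, 0 ≤ h i ⬝ᵥ lam + b i)
    (hdual : ∃ μ : Fin l → ℝ, (∀ i, 0 ≤ μ i) ∧
      ((∑ i, μ i • ((A i)ᵀ * A i)) - vecMulVec c c).PosSemidef ∧
      (∑ i, μ i • h i) = 0) :
    BddAbove {t : ℝ | ∃ (X : Matrix (Fin n) (Fin n) ℝ) (lam : Fin q → ℝ),
      X.PosSemidef ∧ (∀ i, ((A i)ᵀ * A i * X).trace ≤ h i ⬝ᵥ lam + b i) ∧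
      t = (vecMulVec c c * X).trace} ∧
    sSup {t : ℝ | ∃ (X : Matrix (Fin n) (Fin n) ℝ) (lam : Fin q → ℝ),
        X.PosSemidef ∧ (∀ i, ((A i)ᵀ * A i * X).trace ≤ h i ⬝ᵥ lam + b i) ∧
        t = (vecMulVec c c * X).trace} =
      (sSup {t : ℝ | ∃ (x : Fin n → ℝ) (lam : Fin q → ℝ),
        (∀ i, (A i).mulVec x ⬝ᵥ (A i).mulVec x ≤ h i ⬝ᵥ lam + b i) ∧ t = c ⬝ᵥ x}) ^ 2 ∧
    ∀ (x : Fin n → ℝ) (lam : Fin q → ℝ),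
      (∀ i, (A i).mulVec x ⬝ᵥ (A i).mulVec x ≤ h i ⬝ᵥ lam + b i) →
      (∀ (y : Fin n → ℝ) (lam' : Fin q → ℝ),
        (∀ i, (A i).mulVec y ⬝ᵥ (A i).mulVec y ≤ h i ⬝ᵥ lam' + b i) → c ⬝ᵥ y ≤ c ⬝ᵥ x) →
      ((vecMulVec x x).PosSemidef ∧
        (∀ i, ((A i)ᵀ * A i * vecMulVec x x).trace ≤ h i ⬝ᵥ lam + b i)) ∧
      (∀ (X : Matrix (Fin n) (Fin n) ℝ) (lam' : Fin q → ℝ), X.PosSemidef →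
        (∀ i, ((A i)ᵀ * A i * X).trace ≤ h i ⬝ᵥ lam' + b i) →
        (vecMulVec c c * X).trace ≤ (vecMulVec c c * vecMulVec x x).trace) ∧
      (vecMulVec c c * vecMulVec x x).trace = (c ⬝ᵥ x) ^ 2 := by
  obtain ⟨lam0, hlam0⟩ := hfeas
  obtain ⟨μ, hμ, hpsd, hH⟩ := hdual
  have hbS : ∀ (x : Fin n → ℝ) (lam : Fin q → ℝ),
      (∀ i, (A i).mulVec x ⬝ᵥ (A i).mulVec x ≤ h i ⬝ᵥ lam + b i) →
      (c ⬝ᵥ x) ^ 2 ≤ ∑ i, μ i * b i := by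
    intro x lam hx
    have h1 : 0 ≤ x ⬝ᵥ (((∑ i, μ i • ((A i)ᵀ * A i)) - vecMulVec c c) *ᵥ x) := by
      simpa using hpsd.dotProduct_mulVec_nonneg x
    rw [← aux_vv, Matrix.mul_sub, Matrix.trace_sub, Matrix.trace_mul_comm _ (vecMulVec c c),
      aux_cc, Matrix.trace_mul_comm, Matrix.sum_mul, Matrix.trace_sum] at h1
    have h2 : ∑ i, (μ i • ((A i)ᵀ * A i) * vecMulVec x x).trace
        ≤ ∑ i, μ i * (h i ⬝ᵥ lam + b i) := by
      refine Finset.sum_le_sum fun i _ => ?_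
      rw [Matrix.smul_mul, Matrix.trace_smul, aux_xx, smul_eq_mul]
      exact mul_le_mul_of_nonneg_left (hx i) (hμ i)
    have h3 : ∑ i, μ i * (h i ⬝ᵥ lam) = 0 := by
      have := congrArg (fun v => v ⬝ᵥ lam) hH
      simpa [sum_dotProduct, smul_dotProduct] using this
    simp only [mul_add, Finset.sum_add_distrib, h3] at h2
    linarith
  have hbT : ∀ (X : Matrix (Fin n) (Fin n) ℝ) (lam : Fin q → ℝ), X.PosSemidef →
      (∀ i, ((A i)ᵀ * A i * X).trace ≤ h i ⬝ᵥ lam + b i) →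
      0 ≤ (vecMulVec c c * X).trace ∧ ∃ y : Fin n → ℝ,
        c ⬝ᵥ y = √((vecMulVec c c * X).trace) ∧
        ∀ i, (A i).mulVec y ⬝ᵥ (A i).mulVec y ≤ h i ⬝ᵥ lam + b i := by
    intro X lam hX hf
    obtain ⟨h0, y, hy, hA⟩ := aux_key c X hX
    exact ⟨h0, y, hy, fun i => (hA _ (A i)).trans (hf i)⟩
  have hT : BddAbove {t : ℝ | ∃ (X : Matrix (Fin n) (Fin n) ℝ) (lam : Fin q → ℝ),
      X.PosSemidef ∧ (∀ i, ((A i)ᵀ * A i * X).trace ≤ h i ⬝ᵥ lam + b i) ∧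
      t = (vecMulVec c c * X).trace} := by
    refine ⟨∑ i, μ i * b i, ?_⟩
    rintro t ⟨X, lam, hX, hf, rfl⟩
    obtain ⟨h0, y, hy, hA⟩ := hbT X lam hX hf
    have := hbS y lam hA
    rwa [hy, Real.sq_sqrt h0] at this
  have hS : BddAbove {t : ℝ | ∃ (x : Fin n → ℝ) (lam : Fin q → ℝ),
        (∀ i, (A i).mulVec x ⬝ᵥ (A i).mulVec x ≤ h i ⬝ᵥ lam + b i) ∧ t = c ⬝ᵥ x} := by
    refine ⟨√(∑ i, μ i * b i), ?_⟩
    rintro t ⟨x, lam, hf, rfl⟩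
    exact Real.le_sqrt_of_sq_le (hbS x lam hf)
  have h00 : ∀ i, (A i).mulVec 0 ⬝ᵥ (A i).mulVec 0 ≤ h i ⬝ᵥ lam0 + b i := by
    intro i; simpa using hlam0 i
  refine ⟨hT, ?_, ?_⟩
  · apply le_antisymm
    · refine csSup_le ⟨_, 0, lam0, Matrix.PosSemidef.zero, by simpa using hlam0, rfl⟩ ?_
      rintro t ⟨X, lam, hX, hf, rfl⟩
      obtain ⟨h0, y, hy, hA⟩ := hbT X lam hX hf
      have := le_csSup hS ⟨y, lam, hA, hy.symm⟩
      calc _ = (√((vecMulVec c c * X).trace)) ^ 2 := (Real.sq_sqrt h0).symm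
        _ ≤ _ := pow_le_pow_left₀ (Real.sqrt_nonneg _) this 2
    · have hT0 := le_csSup hT ⟨0, lam0, Matrix.PosSemidef.zero, by simpa using hlam0, rfl⟩
      have hS0 := le_csSup hS ⟨0, lam0, h00, rfl⟩
      simp only [Matrix.mul_zero, Matrix.trace_zero] at hT0
      rw [dotProduct_zero] at hS0
      rw [← Real.le_sqrt hS0 hT0]
      refine csSup_le ⟨_, 0, lam0, h00, rfl⟩ ?_
      rintro t ⟨x, lam, hf, rfl⟩
      refine Real.le_sqrt_of_sq_le (le_csSup hT ⟨vecMulVec x x, lam, aux_psd x, ?_, (aux_cc c x).symm⟩)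
      intro i
      rw [aux_xx]; exact hf i
  · intro x lam hf hopt
    refine ⟨⟨aux_psd x, fun i => ?_⟩, ?_, aux_cc c x⟩
    · rw [aux_xx]; exact hf i
    · intro X lam' hX hf'
      obtain ⟨h0, y, hy, hA⟩ := hbT X lam' hX hf'
      have := hopt y lam' hA
      rw [hy] at this
      rw [aux_cc]
      calc _ = (√((vecMulVec c c * X).trace)) ^ 2 := (Real.sq_sqrt h0).symm
        _ ≤ _ := pow_le_pow_left₀ (Real.sqrt_nonneg _) this 2
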